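/- Suppose m ≥ 2. Then the estimators λ^O and λ̂ are both minimax: for every estimator δ : ℕ^m × ℕ → ℝ^m, sup_{λ ∈ (0,∞)^m} R(λ^O, λ) ≤ sup_{λ ∈ (0,∞)^m} R(δ, λ) and sup_{λ ∈ (0,∞)^m} R(λ̂, λ) ≤ sup_{λ ∈ (0,∞)^m} R(δ, λ), the suprema being taken in [0,∞]. -/

import Mathlib

open scoped BigOperators ENNReal

/-- The Poisson(μ) probability of the value `k`. -/
noncomputable def poissonPmf (mu : ℝ) (k : ℕ) : ℝ :=
  mu ^ k * Real.exp (-mu) / (Nat.factorial k)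

/-- Joint pmf of (X, Y): X_1, …, X_m, Y independent, X_i ~ Po(λ_i), Y ~ Po(Σ λ_i). -/
noncomputable def jointPmf (m : ℕ) (lam : Fin m → ℝ) (x : Fin m → ℕ) (y : ℕ) : ℝ :=
  poissonPmf (∑ i, lam i) y * ∏ i, poissonPmf (lam i) (x i)

/-- Risk of an estimator δ under the standardized squared error loss, valued in [0,∞]. -/
noncomputable def risk (m : ℕ) (δ : (Fin m → ℕ) → ℕ → Fin m → ℝ) (lam : Fin m → ℝ) : ℝ≥0∞ :=
  ∑' x : Fin m → ℕ, ∑' y : ℕ,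
    ENNReal.ofReal ((∑ i, (δ x y i - lam i) ^ 2 / lam i) * jointPmf m lam x y)

/-- The maximum likelihood estimator λ^ML (real division by zero is 0, giving 0/0 = 0). -/
noncomputable def estML (m : ℕ) (x : Fin m → ℕ) (y : ℕ) (i : Fin m) : ℝ :=
  ((∑ j, (x j : ℝ)) + (y : ℝ)) / 2 * ((x i : ℝ) / ∑ j, (x j : ℝ))

/-- The shrinkage estimator λ^O. -/
noncomputable def estO (m : ℕ) (x : Fin m → ℕ) (y : ℕ) (i : Fin m) : ℝ :=
  ((∑ j, (x j : ℝ)) + (y : ℝ) + (m : ℝ) - 1) / 2 *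
    ((x i : ℝ) / ((∑ j, (x j : ℝ)) + (m : ℝ) - 1))

/-- The second shrinkage estimator λ̂. -/
noncomputable def estHat (m : ℕ) (x : Fin m → ℕ) (y : ℕ) (i : Fin m) : ℝ :=
  ((∑ j, (x j : ℝ)) + (y : ℝ)) / 2 * ((x i : ℝ) / ((∑ j, (x j : ℝ)) + (m : ℝ) - 1))

/-- The Clevenson–Zidek estimator λ̂X based on X alone. -/
noncomputable def estCZ (m : ℕ) (x : Fin m → ℕ) (y : ℕ) (i : Fin m) : ℝ :=
  (∑ j, (x j : ℝ)) * (x i : ℝ) / ((∑ j, (x j : ℝ)) + (m : ℝ) - 1)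

open MeasureTheory Filter Topology

section PoissonSums

lemma poissonPmf_nonneg {mu : ℝ} (h : 0 ≤ mu) (k : ℕ) : 0 ≤ poissonPmf mu k := by
  unfold poissonPmf; positivity

lemma poissonPmf_succ (mu : ℝ) (k : ℕ) :
    poissonPmf mu (k + 1) * ((k : ℝ) + 1) = mu * poissonPmf mu k := by
  unfold poissonPmf
  rw [Nat.factorial_succ]
  push_cast
  field_simp
  ring

lemma hasSum_poissonPmf (mu : ℝ) : HasSum (poissonPmf mu) 1 := by
  convert! (NormedSpace.expSeries_div_hasSum_exp mu).mul_left (Real.exp (-mu)) using 1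
  · ext k; unfold poissonPmf; ring
  · simp [← Real.exp_eq_exp_ℝ, ← Real.exp_add]

/-- The Stein–Chen identity `E[Y h(Y)] = μ E[h(Y + 1)]`. -/
lemma hasSum_poissonPmf_shift {mu S : ℝ} {h : ℕ → ℝ}
    (hS : HasSum (fun k => h (k + 1) * poissonPmf mu k) S) :
    HasSum (fun k : ℕ => (k : ℝ) * h k * poissonPmf mu k) (mu * S) := by
  rw [← hasSum_nat_add_iff' 1]
  simp only [Finset.range_one, Finset.sum_singleton, Nat.cast_zero, zero_mul, sub_zero]
  convert! hS.mul_left mu using 1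
  ext k
  push_cast
  linear_combination h (k + 1) * poissonPmf_succ mu k

lemma hasSum_poissonPmf_id (mu : ℝ) : HasSum (fun k : ℕ => (k : ℝ) * poissonPmf mu k) mu := by
  have h := hasSum_poissonPmf_shift (mu := mu) (S := 1) (h := fun _ => 1)
    (by simpa using hasSum_poissonPmf mu)
  simpa using h

lemma hasSum_poissonPmf_sq (mu : ℝ) :
    HasSum (fun k : ℕ => (k : ℝ) ^ 2 * poissonPmf mu k) (mu * (mu + 1)) := by
  have h := hasSum_poissonPmf_shift (mu := mu) (S := mu + 1) (h := fun k => (k : ℝ))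
    (by
      convert! (hasSum_poissonPmf_id mu).add (hasSum_poissonPmf mu) using 1
      ext k; push_cast; ring)
  convert! h using 1
  ext k; ring

/-- Expectation of a quadratic polynomial in a Poisson variable. -/
lemma hasSum_poissonPmf_quadratic (mu a b c : ℝ) :
    HasSum (fun k : ℕ => (a * (k : ℝ) ^ 2 + b * k + c) * poissonPmf mu k)
      (a * (mu * (mu + 1)) + b * mu + c) := by
  convert! (((hasSum_poissonPmf_sq mu).mul_left a).add
    ((hasSum_poissonPmf_id mu).mul_left b)).add ((hasSum_poissonPmf mu).mul_left c) using 1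
  · ext k; ring
  · ring

/-- The sum over a product of copies of `ℕ` of a product of nonnegative functions. -/
lemma hasSum_pi_prod {m : ℕ} {f : Fin m → ℕ → ℝ} {a : Fin m → ℝ}
    (hf : ∀ i k, 0 ≤ f i k) (ha : ∀ i, HasSum (f i) (a i)) :
    HasSum (fun x : Fin m → ℕ => ∏ i, f i (x i)) (∏ i, a i) := by
  induction m with
  | zero => simp
  | succ n ih =>
    have ih' := ih (f := fun i => f i.succ) (a := fun i => a i.succ)
      (fun i => hf i.succ) (fun i => ha i.succ)
    rw [← (Fin.consEquiv fun _ : Fin (n + 1) => ℕ).hasSum_iff, Fin.prod_univ_succ]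
    have hs := (ha 0).summable.mul_of_nonneg ih'.summable (hf 0)
      (fun x => Finset.prod_nonneg fun i _ => hf i.succ (x i))
    convert! (ha 0).mul ih' hs using 1
    ext p
    simp [Fin.consEquiv, Fin.prod_univ_succ]

/-- Joint pmf of independent Poisson variables. -/
noncomputable def poissonPiPmf {m : ℕ} (lam : Fin m → ℝ) (x : Fin m → ℕ) : ℝ :=
  ∏ i, poissonPmf (lam i) (x i)

variable {m : ℕ} {lam : Fin m → ℝ}

lemma poissonPiPmf_nonneg (hl : ∀ i, 0 < lam i) (x : Fin m → ℕ) : 0 ≤ poissonPiPmf lam x :=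
  Finset.prod_nonneg fun i _ => poissonPmf_nonneg (hl i).le _

lemma hasSum_poissonPiPmf (hl : ∀ i, 0 < lam i) : HasSum (poissonPiPmf lam) 1 := by
  simpa using! hasSum_pi_prod (fun i k => poissonPmf_nonneg (hl i).le k)
    (fun i => hasSum_poissonPmf (lam i))

lemma prod_add_single (F : Fin m → ℕ → ℝ) (x : Fin m → ℕ) (i : Fin m) :
    ∏ j, F j ((x + Pi.single i 1 : Fin m → ℕ) j) =
      F i (x i + 1) * ∏ j ∈ Finset.univ.erase i, F j (x j) := by
  rw [← Finset.mul_prod_erase _ _ (Finset.mem_univ i)]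
  congr 1
  · simp
  · refine Finset.prod_congr rfl fun j hj => ?_
    simp [Finset.ne_of_mem_erase hj]

lemma sum_add_single (x : Fin m → ℕ) (i : Fin m) :
    ∑ j, (((x + Pi.single i 1 : Fin m → ℕ) j : ℕ) : ℝ) = (∑ j, (x j : ℝ)) + 1 := by
  simp [Finset.sum_add_distrib, Pi.single_apply]

lemma poissonPiPmf_add_single (x : Fin m → ℕ) (i : Fin m) :
    poissonPiPmf lam (x + Pi.single i 1) * ((x i : ℝ) + 1) = lam i * poissonPiPmf lam x := by
  unfold poissonPiPmf
  rw [prod_add_single (fun j => poissonPmf (lam j)), mul_right_comm, poissonPmf_succ,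
    ← Finset.mul_prod_erase _ _ (Finset.mem_univ i), mul_assoc]

lemma hasSum_poissonPiPmf_shift {i : Fin m} {S : ℝ} {h : (Fin m → ℕ) → ℝ}
    (hS : HasSum (fun x => h (x + Pi.single i 1) * poissonPiPmf lam x) S) :
    HasSum (fun x => (x i : ℝ) * h x * poissonPiPmf lam x) (lam i * S) := by
  rw [← (add_left_injective (Pi.single i 1 : Fin m → ℕ)).hasSum_iff]
  · convert! hS.mul_left (lam i) using 1
    ext x
    have := poissonPiPmf_add_single (lam := lam) x i
    simp only [Function.comp, Pi.add_apply, Pi.single_eq_same]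
    push_cast
    linear_combination h (x + Pi.single i 1) * this
  · intro x hx
    have : x i = 0 := by
      by_contra h0
      refine hx ⟨x - Pi.single i 1, ?_⟩
      ext j
      by_cases hj : j = i
      · subst hj; simp; omega
      · simp [hj]
    simp [this]

lemma hasSum_poissonPiPmf_sum_mul {S : ℝ} {h : ℝ → ℝ}
    (hS : HasSum (fun x => h ((∑ j, (x j : ℝ)) + 1) * poissonPiPmf lam x) S) :
    HasSum (fun x => (∑ j, (x j : ℝ)) * h (∑ j, (x j : ℝ)) * poissonPiPmf lam x)
      ((∑ i, lam i) * S) := by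
  have := hasSum_sum (s := Finset.univ) fun (i : Fin m) _ =>
    hasSum_poissonPiPmf_shift (i := i) (h := fun x => h (∑ j, (x j : ℝ)))
      (by simpa only [sum_add_single] using hS)
  convert! this using 1
  · ext x; simp [Finset.sum_mul]
  · rw [Finset.sum_mul]

lemma hasSum_poissonPiPmf_sum_sq_mul (hl : ∀ i, 0 < lam i) {S : ℝ} {h : ℝ → ℝ} (hh : ∀ z, 0 ≤ h z)
    (hS : HasSum (fun x => ((∑ j, (x j : ℝ)) + m) * h ((∑ j, (x j : ℝ)) + 1) *
      poissonPiPmf lam x) S) :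
    HasSum (fun x => (∑ i, (x i : ℝ) ^ 2 / lam i) * h (∑ j, (x j : ℝ)) * poissonPiPmf lam x)
      S := by
  have hsm (i : Fin m) : Summable (fun x : Fin m → ℕ =>
      ((x i : ℝ) + 1) * h ((∑ j, (x j : ℝ)) + 1) * poissonPiPmf lam x) := by
    refine hS.summable.of_nonneg_of_le (fun x => ?_) (fun x => ?_)
    · have := hh ((∑ j, (x j : ℝ)) + 1)
      have := poissonPiPmf_nonneg hl x
      positivity
    · have h1 : (x i : ℝ) ≤ ∑ j, (x j : ℝ) :=
        Finset.single_le_sum (f := fun j => (x j : ℝ)) (fun _ _ => by positivity)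
          (Finset.mem_univ i)
      have h2 : (1 : ℝ) ≤ m := by exact_mod_cast Nat.one_le_of_lt i.2
      have := hh ((∑ j, (x j : ℝ)) + 1)
      have := poissonPiPmf_nonneg hl x
      gcongr
  have h1 (i : Fin m) := hasSum_poissonPiPmf_shift (lam := lam) (i := i)
    (h := fun x => (x i : ℝ) / lam i * h (∑ j, (x j : ℝ)))
    (S := (∑' x : Fin m → ℕ, ((x i : ℝ) + 1) * h ((∑ j, (x j : ℝ)) + 1) * poissonPiPmf lam x)
      / lam i)
    (by
      convert! (hsm i).hasSum.div_const (lam i) using 1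
      ext x
      simp only [sum_add_single]
      simp
      ring)
  have h2 := hasSum_sum (s := Finset.univ) fun (i : Fin m) _ => h1 i
  have h3 : HasSum (fun x => ((∑ j, (x j : ℝ)) + m) * h ((∑ j, (x j : ℝ)) + 1) *
      poissonPiPmf lam x) (∑ i : Fin m, (∑' x : Fin m → ℕ,
        ((x i : ℝ) + 1) * h ((∑ j, (x j : ℝ)) + 1) * poissonPiPmf lam x)) := by
    convert! hasSum_sum (s := Finset.univ) fun (i : Fin m) _ => (hsm i).hasSum using 1
    ext x
    simp [← Finset.sum_mul, Finset.sum_add_distrib]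
  rw [hS.unique h3]
  convert! h2 using 1
  · ext x
    rw [Finset.sum_mul, Finset.sum_mul]
    exact Finset.sum_congr rfl fun i _ => by ring
  · exact Finset.sum_congr rfl fun i _ => by field_simp [(hl i).ne']

/-- Any nonnegative inverse shift `1 / (x· + c)`, `c ≥ 1`, is summable against the pmf. -/
lemma summable_poissonPiPmf_inv (hl : ∀ i, 0 < lam i) {c : ℝ} (hc : 1 ≤ c) :
    Summable (fun x => ((∑ j, (x j : ℝ)) + c)⁻¹ * poissonPiPmf lam x) := by
  refine (hasSum_poissonPiPmf hl).summable.of_nonneg_of_le (fun x => ?_) (fun x => ?_)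
  · have := poissonPiPmf_nonneg hl x
    positivity
  · have : 0 ≤ ∑ j, (x j : ℝ) := by positivity
    exact mul_le_of_le_one_left (poissonPiPmf_nonneg hl x) (inv_le_one_of_one_le₀ (by linarith))

lemma sum_mul_tsum_inv_le_one (hl : ∀ i, 0 < lam i) {c : ℝ} (hc : 1 ≤ c) :
    (∑ i, lam i) * ∑' x, ((∑ j, (x j : ℝ)) + c)⁻¹ * poissonPiPmf lam x ≤ 1 := by
  have hΛ : 0 ≤ ∑ i, lam i := Finset.sum_nonneg fun i _ => (hl i).le
  have h1 := hasSum_poissonPiPmf_sum_mul (lam := lam) (h := fun z => z⁻¹)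
    (summable_poissonPiPmf_inv hl le_rfl).hasSum
  have h2 := hasSum_le (fun x => by
    refine mul_le_of_le_one_left (poissonPiPmf_nonneg hl x) ?_
    exact mul_inv_le_one) h1 (hasSum_poissonPiPmf hl)
  refine le_trans (mul_le_mul_of_nonneg_left ?_ hΛ) h2
  refine (summable_poissonPiPmf_inv hl hc).tsum_le_tsum (fun x => ?_)
    (summable_poissonPiPmf_inv hl le_rfl)
  have := poissonPiPmf_nonneg hl x
  gcongr

end PoissonSums

section UpperBound

/-- The family of shrinkage estimators containing `estO` (`s = 0`) and `estHat` (`s = m - 1`). -/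
noncomputable def shrinkEst (m : ℕ) (s : ℝ) (x : Fin m → ℕ) (y : ℕ) (i : Fin m) : ℝ :=
  (1 + ((y : ℝ) - s) / ((∑ j, (x j : ℝ)) + (m - 1))) / 2 * x i

variable {m : ℕ}

lemma estO_eq_shrinkEst (hm : 2 ≤ m) : estO m = shrinkEst m 0 := by
  ext x y i
  have hm' : (2 : ℝ) ≤ m := by exact_mod_cast hm
  have : 0 ≤ ∑ j, (x j : ℝ) := by positivity
  have h1 : (∑ j, (x j : ℝ)) + (m - 1) ≠ 0 := by linarith
  unfold estO shrinkEst
  rw [add_sub_assoc, add_sub_assoc]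
  field_simp
  ring

lemma estHat_eq_shrinkEst (hm : 2 ≤ m) : estHat m = shrinkEst m (m - 1) := by
  ext x y i
  have hm' : (2 : ℝ) ≤ m := by exact_mod_cast hm
  have : 0 ≤ ∑ j, (x j : ℝ) := by positivity
  have h1 : (∑ j, (x j : ℝ)) + (m - 1) ≠ 0 := by linarith
  unfold estHat shrinkEst
  rw [add_sub_assoc]
  field_simp
  ring

lemma risk_shrinkEst (hm : 2 ≤ m) (s : ℝ) {lam : Fin m → ℝ} (hl : ∀ i, 0 < lam i) :
    risk m (shrinkEst m s) lam = ENNReal.ofReal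
      (m / 4 + 3 * (∑ i, lam i) / 4 - s / 2 +
        (((∑ i, lam i) + ((∑ i, lam i) - s) ^ 2) / 4 - ((∑ i, lam i) - s) * (∑ i, lam i)) *
        ∑' x, ((∑ j, (x j : ℝ)) + m)⁻¹ * poissonPiPmf lam x) := by
  have hm' : (2 : ℝ) ≤ m := by exact_mod_cast hm
  set L := ∑ i, lam i with hL
  have hLpos : 0 ≤ L := Finset.sum_nonneg fun i _ => (hl i).le
  set u := ∑' x, ((∑ j, (x j : ℝ)) + m)⁻¹ * poissonPiPmf lam x with hu
  have hU : HasSum (fun x => ((∑ j, (x j : ℝ)) + m)⁻¹ * poissonPiPmf lam x) u :=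
    (summable_poissonPiPmf_inv hl (by linarith)).hasSum
  have h1 := hasSum_poissonPiPmf hl
  have hZ : HasSum (fun x => (∑ j, (x j : ℝ)) * poissonPiPmf lam x) L := by
    simpa [← hL] using hasSum_poissonPiPmf_sum_mul (lam := lam) (h := fun _ => 1) (S := 1)
      (by simpa using h1)
  let G1 : ℝ → ℝ := fun z => (1 + (L - s) / (z + (m - 1))) / 2
  let G2 : ℝ → ℝ := fun z =>
    (1 + 2 * (L - s) / (z + (m - 1)) + (L + (L - s) ^ 2) / (z + (m - 1)) ^ 2) / 4
  have hG2 (z : ℝ) : 0 ≤ G2 z := by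
    have : G2 z = ((1 + (L - s) / (z + (m - 1))) ^ 2 + L / (z + (m - 1)) ^ 2) / 4 := by
      simp only [G2, div_eq_mul_inv _ (z + _), div_eq_mul_inv _ ((z + _) ^ 2), ← inv_pow]
      ring
    rw [this]; positivity
  have hA := hasSum_poissonPiPmf_sum_sq_mul hl hG2
    (S := (L + m + 2 * (L - s) + (L + (L - s) ^ 2) * u) / 4) (by
      convert! (((hZ.add (h1.mul_left (m : ℝ))).add (h1.mul_left (2 * (L - s)))).add
        (hU.mul_left (L + (L - s) ^ 2))).div_const 4 using 1
      · ext x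
        have : 0 ≤ ∑ j, (x j : ℝ) := by positivity
        have hne : (∑ j, (x j : ℝ)) + m ≠ 0 := by linarith
        have e : (∑ j, (x j : ℝ)) + 1 + (m - 1) = (∑ j, (x j : ℝ)) + m := by ring
        simp only [G2, e]
        field_simp
      · ring)
  have hB := hasSum_poissonPiPmf_sum_mul (lam := lam) (h := G1) (S := (1 + (L - s) * u) / 2) (by
      convert! (h1.add (hU.mul_left (L - s))).div_const 2 using 1
      ext x
      have e : (∑ j, (x j : ℝ)) + 1 + (m - 1) = (∑ j, (x j : ℝ)) + m := by ring
      simp only [G1, e]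
      ring)
  have hy (x : Fin m → ℕ) : HasSum (fun y : ℕ =>
      (∑ i, (shrinkEst m s x y i - lam i) ^ 2 / lam i) * jointPmf m lam x y)
      ((∑ i, (x i : ℝ) ^ 2 / lam i) * G2 (∑ j, (x j : ℝ)) * poissonPiPmf lam x
        - 2 * ((∑ j, (x j : ℝ)) * G1 (∑ j, (x j : ℝ)) * poissonPiPmf lam x)
        + L * poissonPiPmf lam x) := by
    set Z := ∑ j, (x j : ℝ) with hZdef
    set Q := ∑ i, (x i : ℝ) ^ 2 / lam i with hQ
    set w := (Z + (m - 1))⁻¹ with hw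
    have hloss (y : ℕ) : (∑ i, (shrinkEst m s x y i - lam i) ^ 2 / lam i) =
        Q * ((1 + ((y : ℝ) - s) * w) / 2) ^ 2 - Z * (1 + ((y : ℝ) - s) * w) + L := by
      rw [hQ, hZdef, hL, Finset.sum_mul, Finset.sum_mul, ← Finset.sum_sub_distrib,
        ← Finset.sum_add_distrib]
      refine Finset.sum_congr rfl fun i _ => ?_
      have := (hl i).ne'
      simp only [shrinkEst, div_eq_mul_inv _ (Z + _), ← hZdef, ← hw]
      field_simp
      ring
    convert! (hasSum_poissonPmf_quadratic L (Q * w ^ 2 / 4)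
      (Q * (1 - s * w) * w / 2 - Z * w) (Q * (1 - s * w) ^ 2 / 4 - Z * (1 - s * w) + L)).mul_right
      (poissonPiPmf lam x) using 1
    · ext y
      rw [hloss]
      simp only [jointPmf, ← hL, poissonPiPmf]
      ring
    · simp only [G1, G2, div_eq_mul_inv _ (Z + _), div_eq_mul_inv _ ((Z + _) ^ 2), ← inv_pow, ← hw]
      ring
  have hnn (x : Fin m → ℕ) (y : ℕ) :
      0 ≤ (∑ i, (shrinkEst m s x y i - lam i) ^ 2 / lam i) * jointPmf m lam x y :=
    mul_nonneg (Finset.sum_nonneg fun i _ => div_nonneg (sq_nonneg _) (hl i).le)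
      (mul_nonneg (poissonPmf_nonneg hLpos _) (poissonPiPmf_nonneg hl x))
  have hx := (hA.sub (hB.mul_left 2)).add (h1.mul_left L)
  unfold risk
  rw [tsum_congr fun x => (ENNReal.ofReal_tsum_of_nonneg (hnn x) (hy x).summable).symm]
  rw [tsum_congr fun x => congrArg ENNReal.ofReal (hy x).tsum_eq,
    ← ENNReal.ofReal_tsum_of_nonneg (fun x => (hy x).nonneg (hnn x)) hx.summable, hx.tsum_eq]
  congr 1
  ring

lemma risk_shrinkEst_le (hm : 2 ≤ m) {s : ℝ} (hs : s = 0 ∨ s = m - 1) {lam : Fin m → ℝ}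
    (hl : ∀ i, 0 < lam i) :
    risk m (shrinkEst m s) lam ≤ ENNReal.ofReal (m - 1 / 2) := by
  have hm' : (2 : ℝ) ≤ m := by exact_mod_cast hm
  rw [risk_shrinkEst hm s hl]
  apply ENNReal.ofReal_le_ofReal
  set L := ∑ i, lam i with hL
  have hLpos : 0 ≤ L := Finset.sum_nonneg fun i _ => (hl i).le
  have hU := summable_poissonPiPmf_inv hl (c := m) (by linarith)
  have hV := summable_poissonPiPmf_inv hl (c := m - 1) (by linarith)
  set u := ∑' x, ((∑ j, (x j : ℝ)) + m)⁻¹ * poissonPiPmf lam x with hu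
  set v := ∑' x, ((∑ j, (x j : ℝ)) + (m - 1))⁻¹ * poissonPiPmf lam x with hv
  have hv1 : L * v ≤ 1 := sum_mul_tsum_inv_le_one hl (by linarith)
  have hvpos : 0 ≤ v := tsum_nonneg fun x => mul_nonneg
    (inv_nonneg.2 (add_nonneg (by positivity) (by linarith))) (poissonPiPmf_nonneg hl x)
  have huv : u ≤ v := by
    refine hU.tsum_le_tsum (fun x => ?_) hV
    have := poissonPiPmf_nonneg hl x
    have : 0 ≤ ∑ j, (x j : ℝ) := by positivity
    have : 0 < (∑ j, (x j : ℝ)) + ((m : ℝ) - 1) := by linarith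
    gcongr
    linarith
  have hLu : L * u = 1 - (m - 1) * v := by
    have h1 := hasSum_poissonPiPmf_sum_mul (lam := lam) (h := fun z => (z + (m - 1))⁻¹) (S := u)
      (by
        convert! hU.hasSum using 1
        ext x
        congr 2
        ring)
    have h2 := (hasSum_poissonPiPmf hl).sub (hV.hasSum.mul_left ((m : ℝ) - 1))
    refine h1.unique ?_
    convert! h2 using 1
    ext x
    have : 0 ≤ ∑ j, (x j : ℝ) := by positivity
    have : (∑ j, (x j : ℝ)) + (m - 1) ≠ 0 := by linarith
    field_simp
    ring
  have key : m / 4 + 3 * L / 4 + (L + L ^ 2) / 4 * u - L * L * u ≤ m - 1 / 2 := by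
    have : L * (L * u) = L - (m - 1) * (L * v) := by rw [hLu]; ring
    nlinarith
  rcases hs with rfl | rfl
  · linarith
  · have : (m / 4 + 3 * L / 4 - (m - 1) / 2 + ((L + (L - (m - 1)) ^ 2) / 4 - (L - (m - 1)) * L) * u)
      = (m / 4 + 3 * L / 4 + (L + L ^ 2) / 4 * u - L * L * u) + (m - 1) / 2 * (L * u - 1)
        + (m - 1) ^ 2 * u / 4 := by ring
    rw [this, hLu]
    nlinarith [mul_nonneg (sq_nonneg ((m : ℝ) - 1)) hvpos,
      mul_le_mul_of_nonneg_left huv (sq_nonneg ((m : ℝ) - 1))]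

end UpperBound

section Moments

variable {m : ℕ}

/-- Lebesgue measure on the open positive orthant. -/
noncomputable def orthantMeasure (m : ℕ) : Measure (Fin m → ℝ) :=
  Measure.pi fun _ => volume.restrict (Set.Ioi 0)

lemma ae_orthantMeasure_pos (m : ℕ) : ∀ᵐ lam ∂orthantMeasure m, ∀ i, 0 < lam i := by
  have : orthantMeasure m = (Measure.pi fun _ : Fin m => (volume : Measure ℝ)).restrict
      (Set.univ.pi fun _ => Set.Ioi 0) := (Measure.restrict_pi_pi _ _).symm
  rw [this]
  filter_upwards [ae_restrict_mem (MeasurableSet.univ_pi fun _ => measurableSet_Ioi)] with l hl i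
  exact hl i trivial

lemma integrable_pow_mul_exp_neg {b : ℝ} (hb : 0 < b) (n : ℕ) :
    Integrable (fun t : ℝ => t ^ n * Real.exp (-(b * t))) (volume.restrict (Set.Ioi 0)) := by
  have h := integrableOn_rpow_mul_exp_neg_mul_rpow (s := n) (p := 1)
    (lt_of_lt_of_le (by norm_num) (Nat.cast_nonneg n)) one_pos hb
  simpa [IntegrableOn] using h

lemma integral_pow_mul_exp_neg {b : ℝ} (hb : 0 < b) (n : ℕ) :
    ∫ t in Set.Ioi (0 : ℝ), t ^ n * Real.exp (-(b * t)) = n.factorial / b ^ (n + 1) := by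
  have h := Real.integral_rpow_mul_exp_neg_mul_Ioi (a := n + 1) (r := b) (by positivity) hb
  simp only [add_sub_cancel_right, Real.rpow_natCast] at h
  rw [h, Real.Gamma_nat_eq_factorial, ← Nat.cast_add_one, Real.rpow_natCast, one_div, inv_pow]
  field_simp

/-- The unnormalised density `Λ^y ∏ λ_i^{x_i} e^{-bΛ}`. -/
noncomputable def dirichletKernel (b : ℝ) (x : Fin m → ℕ) (y : ℕ) (lam : Fin m → ℝ) : ℝ :=
  (∑ i, lam i) ^ y * (∏ i, lam i ^ x i) * Real.exp (-(b * ∑ i, lam i))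

/-- The integral of `dirichletKernel` over the positive orthant. -/
noncomputable def dirichletMoment (b : ℝ) (x : Fin m → ℕ) (y : ℕ) : ℝ :=
  (∏ i, ((x i).factorial : ℝ)) * ((∑ i, x i) + m).ascFactorial y / b ^ ((∑ i, x i) + m + y)

lemma dirichletKernel_add_single (b : ℝ) (x : Fin m → ℕ) (y : ℕ) (lam : Fin m → ℝ) (i : Fin m) :
    dirichletKernel b (x + Pi.single i 1) y lam = lam i * dirichletKernel b x y lam := by
  unfold dirichletKernel
  rw [prod_add_single (fun j k => lam j ^ k), ← Finset.mul_prod_erase _ _ (Finset.mem_univ i)]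
  ring

lemma dirichletKernel_succ (b : ℝ) (x : Fin m → ℕ) (y : ℕ) (lam : Fin m → ℝ) :
    dirichletKernel b x (y + 1) lam = (∑ i, lam i) * dirichletKernel b x y lam := by
  unfold dirichletKernel
  ring

lemma sum_nat_add_single (x : Fin m → ℕ) (i : Fin m) :
    ∑ j, (x + Pi.single i 1 : Fin m → ℕ) j = (∑ j, x j) + 1 := by
  simp [Finset.sum_add_distrib, Pi.single_apply]

lemma prod_factorial_add_single (x : Fin m → ℕ) (i : Fin m) :
    ∏ j, (((x + Pi.single i 1 : Fin m → ℕ) j).factorial : ℝ) =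
      (x i + 1) * ∏ j, ((x j).factorial : ℝ) := by
  rw [prod_add_single (fun _ k => (k.factorial : ℝ)), Nat.factorial_succ,
    ← Finset.mul_prod_erase _ _ (Finset.mem_univ i)]
  push_cast
  ring

lemma dirichletMoment_add_single {b : ℝ} (hb : 0 < b) (x : Fin m → ℕ) (y : ℕ) (i : Fin m) :
    dirichletMoment b (x + Pi.single i 1) y =
      (x i + 1) * ((∑ j, (x j : ℝ)) + m + y) / (((∑ j, (x j : ℝ)) + m) * b) *
        dirichletMoment b x y := by
  have hm : (0 : ℝ) < m := by exact_mod_cast i.pos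
  have hn : ((∑ j, (x j : ℝ)) + m) ≠ 0 := by positivity
  unfold dirichletMoment
  rw [prod_factorial_add_single, sum_nat_add_single,
    show (∑ j, x j) + 1 + m = ((∑ j, x j) + m) + 1 by ring]
  have h : ((∑ j, (x j : ℝ)) + m) * ((((∑ j, x j) + m + 1).ascFactorial y : ℕ) : ℝ) =
      ((∑ j, (x j : ℝ)) + m + y) * (((∑ j, x j) + m).ascFactorial y : ℕ) := by
    exact_mod_cast Nat.succ_ascFactorial ((∑ j, x j) + m) y
  rw [show (∑ j, x j) + m + 1 + y = ((∑ j, x j) + m + y) + 1 by ring, pow_succ]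
  field_simp
  linear_combination h

lemma dirichletMoment_succ {b : ℝ} (hb : 0 < b) (x : Fin m → ℕ) (y : ℕ) :
    dirichletMoment b x (y + 1) = ((∑ j, (x j : ℝ)) + m + y) / b * dirichletMoment b x y := by
  unfold dirichletMoment
  rw [Nat.ascFactorial_succ, ← add_assoc, pow_succ]
  push_cast
  field_simp

lemma dirichletMoment_pos {b : ℝ} (hb : 0 < b) (hm : 0 < m) (x : Fin m → ℕ) (y : ℕ) :
    0 < dirichletMoment b x y := by
  have : 0 < ((∑ i, x i) + m).ascFactorial y := by
    obtain ⟨k, hk⟩ := Nat.exists_eq_succ_of_ne_zero (n := (∑ i, x i) + m) (by omega)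
    rw [hk]
    exact Nat.ascFactorial_pos k y
  unfold dirichletMoment
  have : 0 < ∏ i, ((x i).factorial : ℝ) := Finset.prod_pos fun i _ => by positivity
  positivity

lemma dirichletKernel_moment (hm : 0 < m) {b : ℝ} (hb : 0 < b) (x : Fin m → ℕ) (y : ℕ) :
    Integrable (dirichletKernel b x y) (orthantMeasure m) ∧
      ∫ lam, dirichletKernel b x y lam ∂orthantMeasure m = dirichletMoment b x y := by
  induction y generalizing x with
  | zero =>
    have e : dirichletKernel b x 0 =
        fun lam : Fin m → ℝ => ∏ i, (lam i ^ x i * Real.exp (-(b * lam i))) := by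
      ext lam
      simp [dirichletKernel, Finset.prod_mul_distrib, ← Real.exp_sum, Finset.mul_sum]
    rw [e]
    constructor
    · exact Integrable.fintype_prod (f := fun i t => t ^ x i * Real.exp (-(b * t)))
        fun i => integrable_pow_mul_exp_neg hb (x i)
    · unfold orthantMeasure
      rw [integral_fintype_prod_eq_prod (fun i t => t ^ x i * Real.exp (-(b * t)))]
      simp only [integral_pow_mul_exp_neg hb]
      rw [Finset.prod_div_distrib, Finset.prod_pow_eq_pow_sum]
      simp [dirichletMoment, Finset.sum_add_distrib]
  | succ y ih =>
    have e : dirichletKernel b x (y + 1) =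
        fun lam => ∑ i : Fin m, dirichletKernel b (x + Pi.single i 1) y lam := by
      ext lam
      simp_rw [dirichletKernel_succ, dirichletKernel_add_single, Finset.sum_mul]
    rw [e]
    refine ⟨integrable_finsetSum _ fun i _ => (ih _).1, ?_⟩
    rw [integral_finsetSum _ fun i _ => (ih _).1]
    simp_rw [(ih _).2, dirichletMoment_add_single hb, dirichletMoment_succ hb]
    rw [← Finset.sum_mul, ← Finset.sum_div, ← Finset.sum_mul, Finset.sum_add_distrib]
    have hm' : (0 : ℝ) < m := by exact_mod_cast hm
    have hn : ((∑ j, (x j : ℝ)) + m) ≠ 0 := by positivity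
    simp only [Finset.sum_const, Finset.card_univ, Fintype.card_fin, nsmul_eq_mul, mul_one]
    field_simp

/-- One-coordinate lower bound for the posterior expected loss. -/
lemma posterior_coordinate_bound (hm : 2 ≤ m) {b : ℝ} (hb : 0 < b) (x : Fin m → ℕ) (y : ℕ)
    (i : Fin m) {d : ℝ} (hd : x i = 0 → d = 0) :
    ∃ B : (Fin m → ℝ) → ℝ, Integrable B (orthantMeasure m) ∧
      (∀ lam : Fin m → ℝ, 0 < lam i → (d - lam i) ^ 2 / lam i * dirichletKernel b x y lam =
        lam i * dirichletKernel b x y lam + B lam) ∧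
      -(x i * ((∑ j, (x j : ℝ)) + (m - 1) + y) / (((∑ j, (x j : ℝ)) + (m - 1)) * b) *
        dirichletMoment b x y) ≤ ∫ lam, B lam ∂orthantMeasure m := by
  by_cases h0 : x i = 0
  · refine ⟨fun _ => 0, integrable_zero _ _ _, fun lam hl => ?_, by simp [h0]⟩
    have := hl.ne'
    rw [hd h0]
    field_simp
    ring
  · obtain ⟨x, rfl⟩ : ∃ z : Fin m → ℕ, x = z + Pi.single i 1 := by
      refine ⟨x - Pi.single i 1, ?_⟩
      ext j
      by_cases hj : j = i
      · subst hj; simp; omega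
      · simp [hj]
    have hA := dirichletKernel_moment (by omega) hb x y
    have hB := dirichletKernel_moment (by omega) hb (x + Pi.single i 1) y
    refine ⟨fun lam => d ^ 2 * dirichletKernel b x y lam -
      2 * d * dirichletKernel b (x + Pi.single i 1) y lam,
      (hA.1.const_mul _).sub (hB.1.const_mul _), fun lam hl => ?_, ?_⟩
    · have := hl.ne'
      simp only [dirichletKernel_add_single]
      field_simp
      ring
    · rw [integral_sub (hA.1.const_mul _) (hB.1.const_mul _), integral_const_mul,
        integral_const_mul, hA.2, hB.2, sum_add_single, dirichletMoment_add_single hb]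
      rw [show (∑ j, (x j : ℝ)) + 1 + ((m : ℝ) - 1) = (∑ j, (x j : ℝ)) + m by ring]
      simp only [Pi.add_apply, Pi.single_eq_same]
      push_cast
      set c := ((x i : ℝ) + 1) * ((∑ j, (x j : ℝ)) + m + y) / (((∑ j, (x j : ℝ)) + m) * b)
      nlinarith [mul_nonneg (dirichletMoment_pos hb (by omega) x y).le (sq_nonneg (d - c))]

/-- Lower bound for the (unnormalised) posterior expected loss of any decision. -/
lemma posterior_loss_bound (hm : 2 ≤ m) {b : ℝ} (hb : 0 < b) (x : Fin m → ℕ) (y : ℕ)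
    {d : Fin m → ℝ} (hd : ∀ i, x i = 0 → d i = 0) :
    Integrable (fun lam => (∑ i, (d i - lam i) ^ 2 / lam i) * dirichletKernel b x y lam)
        (orthantMeasure m) ∧
      dirichletMoment b x y / b * (m + (m - 1) * (y / ((∑ j, (x j : ℝ)) + m))) ≤
        ∫ lam, (∑ i, (d i - lam i) ^ 2 / lam i) * dirichletKernel b x y lam
          ∂orthantMeasure m := by
  choose B hBi hB hBle using fun i => posterior_coordinate_bound hm hb x y i (hd i)
  have hK := dirichletKernel_moment (by omega) hb x (y + 1)
  have hsum := integrable_finsetSum Finset.univ fun i _ => hBi i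
  have hae : (fun lam => (∑ i, (d i - lam i) ^ 2 / lam i) * dirichletKernel b x y lam)
      =ᵐ[orthantMeasure m] fun lam => dirichletKernel b x (y + 1) lam + ∑ i, B i lam := by
    filter_upwards [ae_orthantMeasure_pos m] with lam hl
    rw [dirichletKernel_succ, Finset.sum_mul, Finset.sum_mul, ← Finset.sum_add_distrib]
    exact Finset.sum_congr rfl fun i _ => hB i lam (hl i)
  refine ⟨(hK.1.add hsum).congr hae.symm, ?_⟩
  rw [integral_congr_ae hae, integral_add hK.1 hsum, hK.2, integral_finsetSum _ fun i _ => hBi i,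
    dirichletMoment_succ hb]
  have h := Finset.sum_le_sum fun i (_ : i ∈ Finset.univ) => hBle i
  refine le_trans ?_ (add_le_add_right h _)
  rw [Finset.sum_neg_distrib, ← Finset.sum_mul, ← Finset.sum_div, ← Finset.sum_mul]
  have hD := dirichletMoment_pos hb (by omega) x y
  set D := dirichletMoment b x y
  have hZ : 0 ≤ ∑ j, (x j : ℝ) := by positivity
  set Z := ∑ j, (x j : ℝ)
  have hm' : (2 : ℝ) ≤ m := by exact_mod_cast hm
  have h1 : 0 < Z + (m - 1) := by linarith
  have e : (Z + m + y) / b * D + -(Z * (Z + (m - 1) + y) / ((Z + (m - 1)) * b) * D) =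
      D / b * (m + (m - 1) * (y / (Z + (m - 1)))) := by
    field_simp
    ring
  rw [e]
  have : 0 ≤ (m : ℝ) - 1 := by linarith
  gcongr
  linarith

end Moments

section LowerBound

variable {m : ℕ}

lemma hasSum_ascFactorial {b : ℝ} (hb : 1 < b) {n : ℕ} (hn : 0 < n) :
    HasSum (fun y : ℕ => (n.ascFactorial y : ℝ) / (y.factorial * b ^ (n + y)))
      (1 / (b - 1) ^ n) := by
  obtain ⟨k, rfl⟩ := Nat.exists_eq_succ_of_ne_zero hn.ne'
  have hb0 : b ≠ 0 := by linarith
  have hb1 : b - 1 ≠ 0 := by linarith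
  have h := (hasSum_choose_mul_geometric_of_norm_lt_one k (r := b⁻¹)
    (by rw [norm_inv, Real.norm_of_nonneg (by linarith)]; exact inv_lt_one_of_one_lt₀ hb)).mul_left
    ((b ^ (k + 1))⁻¹)
  convert! h using 1
  · ext y
    rw [Nat.succ_eq_add_one, Nat.ascFactorial_eq_factorial_mul_choose, add_comm k y,
      Nat.choose_symm_add]
    push_cast
    rw [pow_add, inv_pow]
    field_simp
  · rw [show 1 - b⁻¹ = (b - 1) / b by field_simp, div_pow]
    field_simp

lemma hasSum_mul_ascFactorial {b : ℝ} (hb : 1 < b) {n : ℕ} (hn : 0 < n) :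
    HasSum (fun y : ℕ => (n.ascFactorial y : ℝ) / (y.factorial * b ^ (n + y)) * (y / n))
      (1 / (b - 1) ^ (n + 1)) := by
  rw [← hasSum_nat_add_iff' 1]
  simp only [Finset.range_one, Finset.sum_singleton, Nat.cast_zero, zero_div, mul_zero, sub_zero]
  convert! hasSum_ascFactorial hb (Nat.succ_pos n) using 1
  ext y
  have h : (n.ascFactorial (y + 1) : ℝ) = n * (n + 1).ascFactorial y := by
    rw [Nat.ascFactorial_succ, ← Nat.succ_ascFactorial]
    push_cast; rfl
  have hn' : (n : ℝ) ≠ 0 := by positivity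
  have hb0 : b ≠ 0 := by linarith
  rw [h, Nat.factorial_succ, Nat.succ_eq_add_one, show n + (y + 1) = n + 1 + y by ring]
  push_cast
  field_simp

lemma hasSum_geometric_pi {β : ℝ} (hβ : 0 < β) :
    HasSum (fun x : Fin m → ℕ => β ^ m / (1 + β) ^ ((∑ i, x i) + m)) 1 := by
  have h1 : HasSum (fun k : ℕ => β / (1 + β) ^ (k + 1)) 1 := by
    have h := (hasSum_geometric_of_lt_one (r := (1 + β)⁻¹) (by positivity)
      (inv_lt_one_of_one_lt₀ (by linarith))).mul_left (β / (1 + β))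
    convert! h using 1
    · ext k
      rw [pow_succ, inv_pow]
      field_simp
    · rw [show 1 - (1 + β)⁻¹ = β / (1 + β) by field_simp; ring]
      field_simp
  have h := hasSum_pi_prod (m := m) (f := fun _ k => β / (1 + β) ^ (k + 1))
    (fun i k => by positivity) (fun _ => h1)
  convert! h using 1
  · ext x
    simp [Finset.prod_div_distrib, Finset.prod_pow_eq_pow_sum, Finset.sum_add_distrib]
  · simp

/-- An estimator of bounded risk vanishes in every coordinate where `x` does. -/
lemma eq_zero_of_risk_le (hm : 2 ≤ m) {δ : (Fin m → ℕ) → ℕ → Fin m → ℝ} {M : ℝ≥0∞} (hM : M ≠ ⊤)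
    (h : ∀ lam : Fin m → ℝ, (∀ i, 0 < lam i) → risk m δ lam ≤ M)
    (x : Fin m → ℕ) (y : ℕ) (i : Fin m) (hx : x i = 0) : δ x y i = 0 := by
  let l : ℝ → Fin m → ℝ := fun t => Function.update (fun _ => 1) i t
  have hlc : Continuous l := continuous_const.update i continuous_id
  have hl0 (t : ℝ) (ht : 0 ≤ t) (j : Fin m) : 0 ≤ l t j := by
    by_cases hj : j = i
    · subst hj; simpa [l] using ht
    · simp [l, hj]
  have hle (t : ℝ) (ht : 0 < t) : (δ x y i - t) ^ 2 * jointPmf m (l t) x y ≤ M.toReal * t := by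
    have hpos (j : Fin m) : 0 < l t j := by
      by_cases hj : j = i
      · subst hj; simpa [l] using ht
      · simp [l, hj]
    have hJ : 0 ≤ jointPmf m (l t) x y :=
      mul_nonneg (poissonPmf_nonneg (Finset.sum_nonneg fun j _ => (hpos j).le) _)
        (poissonPiPmf_nonneg hpos x)
    have h1 : ENNReal.ofReal ((∑ j, (δ x y j - l t j) ^ 2 / l t j) * jointPmf m (l t) x y) ≤ M :=
      (ENNReal.le_tsum y).trans ((ENNReal.le_tsum (f := fun x => ∑' y, ENNReal.ofReal
        ((∑ j, (δ x y j - l t j) ^ 2 / l t j) * jointPmf m (l t) x y)) x).trans (h _ hpos))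
    have h2 := (ENNReal.ofReal_le_iff_le_toReal hM).1 h1
    have h3 : (δ x y i - t) ^ 2 / t ≤ ∑ j, (δ x y j - l t j) ^ 2 / l t j := by
      have := Finset.single_le_sum (f := fun j => (δ x y j - l t j) ^ 2 / l t j)
        (fun j _ => div_nonneg (sq_nonneg _) (hpos j).le) (Finset.mem_univ i)
      simpa [l] using this
    have h4 := (mul_le_mul_of_nonneg_right h3 hJ).trans h2
    rw [div_mul_eq_mul_div, div_le_iff₀ ht] at h4
    exact h4
  have hJc : Continuous fun t => jointPmf m (l t) x y := by
    unfold jointPmf poissonPmf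
    fun_prop
  have hlim : (δ x y i - 0) ^ 2 * jointPmf m (l 0) x y ≤ M.toReal * 0 := by
    refine le_of_tendsto_of_tendsto (b := 𝓝[>] (0 : ℝ))
      (f := fun t => (δ x y i - t) ^ 2 * jointPmf m (l t) x y) (g := fun t => M.toReal * t) ?_ ?_ ?_
    · exact ((by fun_prop : Continuous fun t => (δ x y i - t) ^ 2 * jointPmf m (l t) x y).tendsto
        0).mono_left nhdsWithin_le_nhds
    · exact ((by fun_prop : Continuous fun t => M.toReal * t).tendsto 0).mono_left
        nhdsWithin_le_nhds
    · filter_upwards [self_mem_nhdsWithin] with t ht using hle t ht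
  have hJ0 : 0 < jointPmf m (l 0) x y := by
    have : Nontrivial (Fin m) := Fin.nontrivial_iff_two_le.2 hm
    obtain ⟨j, hj⟩ := exists_ne i
    have hs : 0 < ∑ j, l 0 j := Finset.sum_pos' (fun j _ => hl0 0 le_rfl j)
      ⟨j, Finset.mem_univ j, by simp [l, hj]⟩
    refine mul_pos (by unfold poissonPmf; positivity) (Finset.prod_pos fun k _ => ?_)
    by_cases hk : k = i
    · subst hk; simp [poissonPmf, l, hx]
    · simp only [poissonPmf, l, Function.update_of_ne hk]; positivity
  rw [mul_zero, sub_zero] at hlim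
  have := nonpos_of_mul_nonpos_left hlim hJ0
  exact pow_eq_zero_iff two_ne_zero |>.1 (le_antisymm this (sq_nonneg _))

/-- Bayes risk lower bound for the prior with i.i.d. exponential coordinates of rate `β`. -/
lemma bayes_risk_bound (hm : 2 ≤ m) {δ : (Fin m → ℕ) → ℕ → Fin m → ℝ} {M : ℝ≥0∞} (hM : M ≠ ⊤)
    (h : ∀ lam : Fin m → ℝ, (∀ i, 0 < lam i) → risk m δ lam ≤ M) {β : ℝ} (hβ : 0 < β) :
    ENNReal.ofReal ((m + (m - 1) / (1 + β)) / (2 + β)) ≤ M := by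
  have hm' : (2 : ℝ) ≤ m := by exact_mod_cast hm
  have hb : 0 < 2 + β := by linarith
  let π : (Fin m → ℝ) → ℝ≥0∞ := fun lam => ENNReal.ofReal (β ^ m * dirichletKernel β 0 0 lam)
  have hK0 (b : ℝ) (x : Fin m → ℕ) (y : ℕ) :
      ∀ᵐ lam ∂orthantMeasure m, 0 ≤ dirichletKernel b x y lam := by
    filter_upwards [ae_orthantMeasure_pos m] with lam hl
    exact mul_nonneg (mul_nonneg (pow_nonneg (Finset.sum_nonneg fun i _ => (hl i).le) _)
      (Finset.prod_nonneg fun i _ => pow_nonneg (hl i).le _)) (Real.exp_pos _).le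
  have hπ : ∫⁻ lam, π lam ∂orthantMeasure m = 1 := by
    have hK := dirichletKernel_moment (m := m) (by omega) hβ 0 0
    rw [← ofReal_integral_eq_lintegral_ofReal (hK.1.const_mul _)
      ((hK0 _ _ _).mono fun lam hl => mul_nonneg (by positivity) hl), integral_const_mul, hK.2]
    simp [dirichletMoment, hβ.ne']
  let t : (Fin m → ℕ) → ℕ → ℝ := fun x y =>
    β ^ m / (y.factorial * ∏ i, ((x i).factorial : ℝ)) * (dirichletMoment (2 + β) x y / (2 + β) *
      (m + (m - 1) * (y / ((∑ j, (x j : ℝ)) + m))))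
  have ht (x : Fin m → ℕ) (y : ℕ) : 0 ≤ t x y := by
    have := dirichletMoment_pos hb (by omega) x y
    have : 0 ≤ (m : ℝ) - 1 := by linarith
    simp only [t]
    positivity
  have hterm (x : Fin m → ℕ) (y : ℕ) : ENNReal.ofReal (t x y) ≤
      ∫⁻ lam, π lam * ENNReal.ofReal ((∑ i, (δ x y i - lam i) ^ 2 / lam i) * jointPmf m lam x y)
        ∂orthantMeasure m := by
    have hp := posterior_loss_bound hm hb x y
      (fun i => eq_zero_of_risk_le hm hM h x y i)
    set c := β ^ m / (y.factorial * ∏ i, ((x i).factorial : ℝ)) with hc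
    have hc0 : 0 ≤ c := by positivity
    have hae : (fun lam => π lam *
        ENNReal.ofReal ((∑ i, (δ x y i - lam i) ^ 2 / lam i) * jointPmf m lam x y))
        =ᵐ[orthantMeasure m] fun lam => ENNReal.ofReal
          (c * ((∑ i, (δ x y i - lam i) ^ 2 / lam i) * dirichletKernel (2 + β) x y lam)) := by
      filter_upwards [hK0 β 0 0] with lam hl
      simp only [π]
      rw [← ENNReal.ofReal_mul (by positivity)]
      congr 1
      simp only [hc, dirichletKernel, jointPmf, poissonPmf, Finset.prod_div_distrib,
        Finset.prod_mul_distrib, ← Real.exp_sum, Finset.sum_neg_distrib]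
      rw [show -((2 + β) * ∑ i, lam i) = -(β * ∑ i, lam i) + (-∑ i, lam i) + (-∑ i, lam i) by ring,
        Real.exp_add, Real.exp_add]
      simp only [Pi.zero_apply, pow_zero, Finset.prod_const_one]
      have : (∏ i, ((x i).factorial : ℝ)) ≠ 0 :=
        Finset.prod_ne_zero_iff.2 fun i _ => by positivity
      field_simp
    rw [lintegral_congr_ae hae, ← ofReal_integral_eq_lintegral_ofReal (hp.1.const_mul c),
      integral_const_mul]
    · exact ENNReal.ofReal_le_ofReal (mul_le_mul_of_nonneg_left hp.2 hc0)
    · filter_upwards [ae_orthantMeasure_pos m, hK0 (2 + β) x y] with lam hl hk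
      exact mul_nonneg hc0 (mul_nonneg
        (Finset.sum_nonneg fun i _ => div_nonneg (sq_nonneg _) (hl i).le) hk)
  have hty (x : Fin m → ℕ) : HasSum (t x) (β ^ m / (1 + β) ^ ((∑ i, x i) + m) *
      ((m + (m - 1) / (1 + β)) / (2 + β))) := by
    have hn : 0 < (∑ i, x i) + m := by omega
    have h1 := ((hasSum_ascFactorial (b := 2 + β) (by linarith) hn).mul_left
      (β ^ m * m / (2 + β))).add ((hasSum_mul_ascFactorial (b := 2 + β) (by linarith) hn).mul_left
      (β ^ m * (m - 1) / (2 + β)))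
    convert! h1 using 1
    · ext y
      simp only [t, dirichletMoment]
      have : (∏ i, ((x i).factorial : ℝ)) ≠ 0 :=
        Finset.prod_ne_zero_iff.2 fun i _ => by positivity
      push_cast
      field_simp
    · rw [show 2 + β - 1 = 1 + β by ring, pow_succ _ ((∑ i, x i) + m)]
      field_simp
  have htx := (hasSum_geometric_pi (m := m) hβ).mul_right ((m + (m - 1) / (1 + β)) / (2 + β))
  have hmeas (x : Fin m → ℕ) (y : ℕ) : Measurable fun lam : Fin m → ℝ =>
      ENNReal.ofReal ((∑ i, (δ x y i - lam i) ^ 2 / lam i) * jointPmf m lam x y) := by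
    unfold jointPmf poissonPmf
    fun_prop
  have hπm : Measurable π := by
    simp only [π]
    unfold dirichletKernel
    fun_prop
  calc ENNReal.ofReal ((m + (m - 1) / (1 + β)) / (2 + β))
      = ∑' x, ∑' y, ENNReal.ofReal (t x y) := by
        rw [tsum_congr fun x => (ENNReal.ofReal_tsum_of_nonneg (ht x) (hty x).summable).symm,
          tsum_congr fun x => congrArg ENNReal.ofReal (hty x).tsum_eq,
          ← ENNReal.ofReal_tsum_of_nonneg (fun x => (hty x).nonneg (ht x)) htx.summable,
          htx.tsum_eq, one_mul]
    _ ≤ ∑' x, ∑' y, ∫⁻ lam, π lam *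
          ENNReal.ofReal ((∑ i, (δ x y i - lam i) ^ 2 / lam i) * jointPmf m lam x y)
          ∂orthantMeasure m :=
        ENNReal.tsum_le_tsum fun x => ENNReal.tsum_le_tsum fun y => hterm x y
    _ = ∫⁻ lam, π lam * risk m δ lam ∂orthantMeasure m := by
        simp_rw [risk, ← ENNReal.tsum_mul_left]
        have hm₂ (x : Fin m → ℕ) (y : ℕ) : Measurable fun lam => π lam *
            ENNReal.ofReal ((∑ i, (δ x y i - lam i) ^ 2 / lam i) * jointPmf m lam x y) :=
          hπm.mul (hmeas x y)
        rw [lintegral_tsum fun x => (Measurable.tsum fun y => hm₂ x y).aemeasurable]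
        exact tsum_congr fun x => (lintegral_tsum fun y => (hm₂ x y).aemeasurable).symm
    _ ≤ ∫⁻ lam, π lam * M ∂orthantMeasure m := by
        refine lintegral_mono_ae ?_
        filter_upwards [ae_orthantMeasure_pos m] with lam hl
        gcongr
        exact h lam hl
    _ = M := by rw [lintegral_mul_const _ hπm, hπ, one_mul]

lemma le_of_forall_risk_le (hm : 2 ≤ m) {δ : (Fin m → ℕ) → ℕ → Fin m → ℝ} {M : ℝ≥0∞}
    (h : ∀ lam : Fin m → ℝ, (∀ i, 0 < lam i) → risk m δ lam ≤ M) :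
    ENNReal.ofReal (m - 1 / 2) ≤ M := by
  rcases eq_or_ne M ⊤ with rfl | hM
  · exact le_top
  have hlim : Tendsto (fun β : ℝ => ENNReal.ofReal ((m + (m - 1) / (1 + β)) / (2 + β)))
      (𝓝[>] 0) (𝓝 (ENNReal.ofReal (m - 1 / 2))) := by
    refine ENNReal.tendsto_ofReal (tendsto_nhdsWithin_of_tendsto_nhds ?_)
    have hc : ContinuousAt (fun β : ℝ => ((m : ℝ) + (m - 1) / (1 + β)) / (2 + β)) 0 := by
      fun_prop (disch := norm_num)
    have := hc.tendsto
    rwa [show ((m : ℝ) + (m - 1) / (1 + 0)) / (2 + 0) = m - 1 / 2 by ring] at this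
  refine le_of_tendsto hlim ?_
  filter_upwards [self_mem_nhdsWithin] with β hβ using bayes_risk_bound hm hM h hβ

end LowerBound

/- STATEMENT 8: for m ≥ 2, the estimators λ^O and λ̂ are minimax. -/
theorem stmt_8 (m : ℕ) (hm : 2 ≤ m) (δ : (Fin m → ℕ) → ℕ → Fin m → ℝ) :
    (⨆ lam ∈ {l : Fin m → ℝ | ∀ i, 0 < l i}, risk m (estO m) lam) ≤
      (⨆ lam ∈ {l : Fin m → ℝ | ∀ i, 0 < l i}, risk m δ lam) ∧
    (⨆ lam ∈ {l : Fin m → ℝ | ∀ i, 0 < l i}, risk m (estHat m) lam) ≤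
      (⨆ lam ∈ {l : Fin m → ℝ | ∀ i, 0 < l i}, risk m δ lam) := by
  have hlow := le_of_forall_risk_le hm
    fun lam hl => le_iSup₂ (f := fun l (_ : l ∈ {l : Fin m → ℝ | ∀ i, 0 < l i}) => risk m δ l) lam hl
  constructor
  · rw [estO_eq_shrinkEst hm]
    exact (iSup₂_le fun lam hl => risk_shrinkEst_le hm (.inl rfl) hl).trans hlow
  · rw [estHat_eq_shrinkEst hm]
    exact (iSup₂_le fun lam hl => risk_shrinkEst_le hm (.inr rfl) hl).trans hlow
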